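/- Let F be a field and C₂ ⊊ C₁ ⊆ F^{m×n} nested linear codes with ℓ = dim(C₁/C₂). Then 0 ≤ d_{M,r+1}(C₁,C₂) − d_{M,r}(C₁,C₂) ≤ min{m,n} for all 1 ≤ r ≤ ℓ−1, and d_{M,r}(C₁,C₂) + 1 ≤ d_{M,r+m}(C₁,C₂) for all 1 ≤ r ≤ ℓ−m. -/

import Mathlib

noncomputable section

open Matrix

variable {F : Type*} [Field F]

/-- The row space of a matrix: the span of its rows. -/
def rowSpace {m n : ℕ} (C : Matrix (Fin m) (Fin n) F) : Submodule F (Fin n → F) :=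
  Submodule.span F (Set.range C)

/-- The rank support space of a subspace `L ⊆ F^n`:
all `m × n` matrices whose row space is contained in `L`. -/
def rss (m : ℕ) {n : ℕ} (L : Submodule F (Fin n → F)) :
    Submodule F (Matrix (Fin m) (Fin n) F) where
  carrier := {V | rowSpace V ≤ L}
  add_mem' := by
    intro a b ha hb
    simp only [Set.mem_setOf_eq, rowSpace, Submodule.span_le] at *
    rintro x ⟨i, rfl⟩
    exact L.add_mem (ha (Set.mem_range_self i)) (hb (Set.mem_range_self i))
  zero_mem' := by
    simp only [Set.mem_setOf_eq, rowSpace, Submodule.span_le]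
    rintro x ⟨i, rfl⟩
    exact L.zero_mem
  smul_mem' := by
    intro c a ha
    simp only [Set.mem_setOf_eq, rowSpace, Submodule.span_le] at *
    rintro x ⟨i, rfl⟩
    exact L.smul_mem c (ha (Set.mem_range_self i))

/-- The `r`-th relative generalized matrix weight of a pair of nested linear codes. -/
def dM {m n : ℕ} (C₁ C₂ : Submodule F (Matrix (Fin m) (Fin n) F)) (r : ℕ) : ℕ :=
  sInf { d | ∃ L : Submodule F (Fin n → F), Module.finrank F L = d ∧
    Module.finrank F ↥(C₁ ⊓ rss m L) - Module.finrank F ↥(C₂ ⊓ rss m L) ≥ r }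

lemma mem_rss {m n : ℕ} {L : Submodule F (Fin n → F)} {V : Matrix (Fin m) (Fin n) F} :
    V ∈ rss m L ↔ ∀ i, V i ∈ L := by
  change Submodule.span F (Set.range V) ≤ L ↔ _
  rw [Submodule.span_le]
  exact Set.range_subset_iff

lemma rss_mono {m n : ℕ} {L L' : Submodule F (Fin n → F)} (h : L ≤ L') : rss m L ≤ rss m L' :=
  fun _ hV => mem_rss.2 fun i => h (mem_rss.1 hV i)

lemma rss_top (m n : ℕ) : rss m (⊤ : Submodule F (Fin n → F)) = ⊤ :=
  eq_top_iff.2 fun _ _ => mem_rss.2 fun _ => Submodule.mem_top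

lemma finrank_rowSpace_le {m n : ℕ} (C : Matrix (Fin m) (Fin n) F) :
    Module.finrank F (rowSpace C) ≤ min m n := by
  refine le_min ?_ ?_
  · have h := finrank_range_le_card (R := F) (b := (C : Fin m → Fin n → F))
    rwa [Fintype.card_fin] at h
  · simpa using Submodule.finrank_le (rowSpace C)

/-- The relative dimension on a support equals the dimension of the trace of `C₁` modulo `C₂`. -/
lemma finrank_sup_inf_rss {m n : ℕ} {C₁ C₂ : Submodule F (Matrix (Fin m) (Fin n) F)}
    (h21 : C₂ ≤ C₁) (L : Submodule F (Fin n → F)) :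
    Module.finrank F ↥(C₂ ⊔ (C₁ ⊓ rss m L)) + Module.finrank F ↥(C₂ ⊓ rss m L) =
      Module.finrank F ↥C₂ + Module.finrank F ↥(C₁ ⊓ rss m L) := by
  rw [← Submodule.finrank_sup_add_finrank_inf_eq C₂ (C₁ ⊓ rss m L), ← inf_assoc,
    inf_eq_left.2 h21]

/-- Enlarging a support by at most `min m n` dimensions strictly increases the trace of `C₁`
modulo `C₂`, unless that trace is already everything. -/
lemma exists_lt_sup_inf_rss {m n : ℕ} {C₁ C₂ : Submodule F (Matrix (Fin m) (Fin n) F)}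
    {L : Submodule F (Fin n → F)} (h : ¬ C₁ ≤ C₂ ⊔ (C₁ ⊓ rss m L)) :
    ∃ L' : Submodule F (Fin n → F),
      Module.finrank F L' ≤ Module.finrank F L + min m n ∧
      C₂ ⊔ (C₁ ⊓ rss m L) < C₂ ⊔ (C₁ ⊓ rss m L') := by
  obtain ⟨C, hC, hCL⟩ := SetLike.not_le_iff_exists.1 h
  refine ⟨L ⊔ rowSpace C, ?_, SetLike.lt_iff_le_and_exists.2
    ⟨sup_le_sup_left (inf_le_inf_left _ (rss_mono le_sup_left)) _, C, ?_, hCL⟩⟩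
  · exact (Submodule.finrank_add_le_finrank_add_finrank _ _).trans
      (Nat.add_le_add_left (finrank_rowSpace_le C) _)
  · exact Submodule.mem_sup_right ⟨hC, mem_rss.2 fun i =>
      Submodule.mem_sup_right (Submodule.subset_span ⟨i, rfl⟩)⟩

/-- The matrices whose `j`-th column vanishes cut down a space of matrices by at most `m`
dimensions. -/
lemma finrank_inf_rss_le {m n : ℕ} (C : Submodule F (Matrix (Fin m) (Fin n) F))
    (L : Submodule F (Fin n → F)) (j : Fin n) :
    Module.finrank F ↥(C ⊓ rss m L) ≤
      Module.finrank F ↥(C ⊓ rss m (L ⊓ LinearMap.ker (LinearMap.proj (R := F) j))) + m := by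
  let f : Matrix (Fin m) (Fin n) F →ₗ[F] (Fin m → F) :=
    { toFun := fun M i => M i j
      map_add' := fun _ _ => rfl
      map_smul' := fun _ _ => rfl }
  have hker : C ⊓ rss m (L ⊓ LinearMap.ker (LinearMap.proj (R := F) j)) =
      (C ⊓ rss m L) ⊓ LinearMap.ker f := by
    ext M
    simp only [Submodule.mem_inf, mem_rss, LinearMap.mem_ker, LinearMap.proj_apply, and_assoc,
      forall_and, funext_iff]
    rfl
  have h1 := Submodule.finrank_sup_add_finrank_inf_eq (C ⊓ rss m L) (LinearMap.ker f)
  have h2 := f.finrank_range_add_finrank_ker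
  have h3 : Module.finrank F (LinearMap.range f) ≤ m := by
    simpa using Submodule.finrank_le (LinearMap.range f)
  have h4 := Submodule.finrank_le ((C ⊓ rss m L) ⊔ LinearMap.ker f)
  rw [hker]
  omega

lemma dM_le {m n : ℕ} {C₁ C₂ : Submodule F (Matrix (Fin m) (Fin n) F)} {r : ℕ}
    {L : Submodule F (Fin n → F)}
    (h : r ≤ Module.finrank F ↥(C₁ ⊓ rss m L) - Module.finrank F ↥(C₂ ⊓ rss m L)) :
    dM C₁ C₂ r ≤ Module.finrank F L :=
  Nat.sInf_le ⟨L, rfl, h⟩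

lemma exists_finrank_eq_dM {m n : ℕ} {C₁ C₂ : Submodule F (Matrix (Fin m) (Fin n) F)} {r : ℕ}
    (hr : r ≤ Module.finrank F ↥C₁ - Module.finrank F ↥C₂) :
    ∃ L : Submodule F (Fin n → F), Module.finrank F L = dM C₁ C₂ r ∧
      r ≤ Module.finrank F ↥(C₁ ⊓ rss m L) - Module.finrank F ↥(C₂ ⊓ rss m L) :=
  Nat.sInf_mem (s := { d | ∃ L : Submodule F (Fin n → F), Module.finrank F L = d ∧
    Module.finrank F ↥(C₁ ⊓ rss m L) - Module.finrank F ↥(C₂ ⊓ rss m L) ≥ r })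
    ⟨_, ⊤, rfl, by rwa [rss_top, inf_top_eq, inf_top_eq]⟩

/-- Monotonicity of relative generalized matrix weights:
`0 ≤ d_{M,r+1} - d_{M,r} ≤ min{m,n}` for `1 ≤ r ≤ ℓ-1`, and
`d_{M,r} + 1 ≤ d_{M,r+m}` for `1 ≤ r ≤ ℓ-m`. -/
theorem stmt_5 (m n : ℕ) (C₁ C₂ : Submodule F (Matrix (Fin m) (Fin n) F))
    (h21 : C₂ ≤ C₁) (hne : C₂ ≠ C₁) (ℓ : ℕ)
    (hℓ : ℓ = Module.finrank F ↥C₁ - Module.finrank F ↥C₂) :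
    (∀ r : ℕ, 1 ≤ r → r ≤ ℓ - 1 →
      dM C₁ C₂ r ≤ dM C₁ C₂ (r + 1) ∧ dM C₁ C₂ (r + 1) ≤ dM C₁ C₂ r + min m n) ∧
    (∀ r : ℕ, 1 ≤ r → r ≤ ℓ - m → dM C₁ C₂ r + 1 ≤ dM C₁ C₂ (r + m)) := by
  refine ⟨fun r hr1 hr => ⟨?_, ?_⟩, fun r hr1 hr => ?_⟩
  · obtain ⟨L, hL, hrL⟩ := exists_finrank_eq_dM (C₁ := C₁) (C₂ := C₂) (r := r + 1) (by omega)
    exact hL ▸ dM_le (by omega)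
  · obtain ⟨L, hL, hrL⟩ := exists_finrank_eq_dM (C₁ := C₁) (C₂ := C₂) (r := r) (by omega)
    have hg := finrank_sup_inf_rss h21 L
    by_cases hC : C₁ ≤ C₂ ⊔ (C₁ ⊓ rss m L)
    · have := Submodule.finrank_mono hC
      exact (dM_le (L := L) (by omega)).trans (by omega)
    · obtain ⟨L', hL', hlt⟩ := exists_lt_sup_inf_rss hC
      have hg' := finrank_sup_inf_rss h21 L'
      have := Submodule.finrank_lt_finrank_of_lt hlt
      exact (dM_le (L := L') (by omega)).trans (by omega)
  · obtain ⟨L, hL, hrL⟩ := exists_finrank_eq_dM (C₁ := C₁) (C₂ := C₂) (r := r + m) (by omega)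
    have hbot : L ≠ ⊥ := by
      rintro rfl
      have hz : C₁ ⊓ rss m (⊥ : Submodule F (Fin n → F)) = ⊥ :=
        eq_bot_iff.2 fun V hV => funext fun i => (Submodule.mem_bot F).1 (mem_rss.1 hV.2 i)
      rw [hz, finrank_bot] at hrL
      omega
    obtain ⟨v, hv, hv0⟩ := L.exists_mem_ne_zero_of_ne_bot hbot
    obtain ⟨j, hj⟩ := Function.ne_iff.1 hv0
    have hlt : L ⊓ LinearMap.ker (LinearMap.proj (R := F) j) < L :=
      SetLike.lt_iff_le_and_exists.2 ⟨inf_le_left, v, hv, fun h => hj h.2⟩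
    have h1 := finrank_inf_rss_le C₁ L j
    have h2 := Submodule.finrank_mono (inf_le_inf_left C₂ (rss_mono (m := m) hlt.le))
    have h3 := Submodule.finrank_lt_finrank_of_lt hlt
    have h4 := dM_le (C₁ := C₁) (C₂ := C₂) (r := r)
      (L := L ⊓ LinearMap.ker (LinearMap.proj (R := F) j)) (by omega)
    omega

end
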